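/- Let n ≥ 3 be an integer, and for m ≥ 2 set F_m(a) = 2a^{m−1}e^{−a²/4} − 4∫₀^a r^{m−1}e^{−r²/4}dr, G_m(b) = 2b^{m−1}e^{−b²/4} + 4∫₀^b r^{m−1}e^{−r²/4}dr, a_m = −2 + √(2(m+1)) and b_m = 2 + √(2(m+1)). Then F_{n+2}(a_{n+2}) + G_{n+2}(b_{n+2}) < 2n (F_n(a_n) + G_n(b_n)). -/

import Mathlib

open Real MeasureTheory

/-- The left-side contribution to the perimeter of the rectangle. -/
noncomputable def rectF (m : ℕ) (a : ℝ) : ℝ :=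
  2 * a ^ (m - 1) * Real.exp (-a ^ 2 / 4) -
    4 * ∫ r in (0:ℝ)..a, r ^ (m - 1) * Real.exp (-r ^ 2 / 4)

/-- The right-side contribution to the perimeter of the rectangle. -/
noncomputable def rectG (m : ℕ) (b : ℝ) : ℝ :=
  2 * b ^ (m - 1) * Real.exp (-b ^ 2 / 4) +
    4 * ∫ r in (0:ℝ)..b, r ^ (m - 1) * Real.exp (-r ^ 2 / 4)

/-- The maximizer of `F_m` over `[0,∞)`. -/
noncomputable def rectA (m : ℕ) : ℝ := -2 + Real.sqrt (2 * ((m : ℝ) + 1))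

/-- The maximizer of `G_m` over `[0,∞)`. -/
noncomputable def rectB (m : ℕ) : ℝ := 2 + Real.sqrt (2 * ((m : ℝ) + 1))

theorem hasDerivAt_exp_neg_sq_div_four (x : ℝ) :
    HasDerivAt (fun x : ℝ => Real.exp (-x ^ 2 / 4)) (-(x / 2) * Real.exp (-x ^ 2 / 4)) x := by
  have h : HasDerivAt (fun x : ℝ => -x ^ 2 / 4) (-(x / 2)) x := by
    refine ((hasDerivAt_pow 2 x).neg.div_const 4).congr_deriv ?_
    norm_num
    ring
  exact h.exp.congr_deriv (mul_comm _ _)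

theorem hasDerivAt_pow_succ_mul_gaussian (k : ℕ) (x : ℝ) :
    HasDerivAt (fun x : ℝ => x ^ (k + 1) * Real.exp (-x ^ 2 / 4))
      (x ^ k * Real.exp (-x ^ 2 / 4) * ((k + 1) - x ^ 2 / 2)) x := by
  refine ((hasDerivAt_pow (k + 1) x).mul (hasDerivAt_exp_neg_sq_div_four x)).congr_deriv ?_
  simp only [Nat.add_sub_cancel]
  push_cast
  ring

theorem continuous_pow_mul_gaussian (k : ℕ) :
    Continuous (fun x : ℝ => x ^ k * Real.exp (-x ^ 2 / 4)) := by
  fun_prop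

theorem hasDerivAt_integral_pow_mul_gaussian (k : ℕ) (x : ℝ) :
    HasDerivAt (fun x : ℝ => ∫ r in (0:ℝ)..x, r ^ k * Real.exp (-r ^ 2 / 4))
      (x ^ k * Real.exp (-x ^ 2 / 4)) x :=
  ((continuous_pow_mul_gaussian k).integral_hasStrictDerivAt 0 x).hasDerivAt

/-- Integration by parts for the Gaussian moments. -/
theorem integral_pow_add_two_mul_gaussian (k : ℕ) (x : ℝ) :
    ∫ r in (0:ℝ)..x, r ^ (k + 2) * Real.exp (-r ^ 2 / 4) =
      2 * (k + 1) * (∫ r in (0:ℝ)..x, r ^ k * Real.exp (-r ^ 2 / 4)) -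
        2 * (x ^ (k + 1) * Real.exp (-x ^ 2 / 4)) := by
  have h := intervalIntegral.integral_eq_sub_of_hasDerivAt (a := 0) (b := x)
    (fun y _ => hasDerivAt_pow_succ_mul_gaussian k y)
    ((by fun_prop : Continuous fun y : ℝ =>
      y ^ k * Real.exp (-y ^ 2 / 4) * ((k + 1) - y ^ 2 / 2)).intervalIntegrable 0 x)
  have e : (fun y : ℝ => y ^ k * Real.exp (-y ^ 2 / 4) * ((k + 1) - y ^ 2 / 2)) =
      fun y => (k + 1) * (y ^ k * Real.exp (-y ^ 2 / 4)) -
        1 / 2 * (y ^ (k + 2) * Real.exp (-y ^ 2 / 4)) := by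
    funext y
    ring
  rw [e, intervalIntegral.integral_sub
      (((continuous_pow_mul_gaussian k).const_mul _).intervalIntegrable _ _)
      (((continuous_pow_mul_gaussian (k + 2)).const_mul _).intervalIntegrable _ _),
    intervalIntegral.integral_const_mul, intervalIntegral.integral_const_mul] at h
  simp only [ne_eq, Nat.add_eq_zero_iff, one_ne_zero, and_false, not_false_eq_true, zero_pow,
    zero_mul, sub_zero] at h
  linarith

theorem rectF_add_two (k : ℕ) (a : ℝ) :
    rectF (k + 2 + 2) a = 2 * (k + 2) * rectF (k + 2) a +
      2 * (a ^ (k + 1) * Real.exp (-a ^ 2 / 4)) * (a ^ 2 + 4 * a - 2 * (k + 2)) := by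
  have h := integral_pow_add_two_mul_gaussian (k + 1) a
  simp only [rectF, show k + 2 + 2 - 1 = k + 1 + 2 by omega, show k + 2 - 1 = k + 1 by omega]
  rw [h]
  push_cast
  ring

theorem rectG_add_two (k : ℕ) (b : ℝ) :
    rectG (k + 2 + 2) b = 2 * (k + 2) * rectG (k + 2) b +
      2 * (b ^ (k + 1) * Real.exp (-b ^ 2 / 4)) * (b ^ 2 - 4 * b - 2 * (k + 2)) := by
  have h := integral_pow_add_two_mul_gaussian (k + 1) b
  simp only [rectG, show k + 2 + 2 - 1 = k + 1 + 2 by omega, show k + 2 - 1 = k + 1 by omega]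
  rw [h]
  push_cast
  ring

theorem hasDerivAt_rectF (k : ℕ) (a : ℝ) :
    HasDerivAt (rectF (k + 2))
      (a ^ k * Real.exp (-a ^ 2 / 4) * (2 * (k + 1) - a ^ 2 - 4 * a)) a := by
  have h := ((hasDerivAt_pow_succ_mul_gaussian k a).const_mul 2).sub
    ((hasDerivAt_integral_pow_mul_gaussian (k + 1) a).const_mul 4)
  refine (h.congr_deriv ?_).congr_of_eventuallyEq (.of_forall fun x => ?_)
  · ring
  · simp only [rectF, show k + 2 - 1 = k + 1 by omega, Pi.sub_apply, mul_assoc]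

theorem hasDerivAt_rectG (k : ℕ) (b : ℝ) :
    HasDerivAt (rectG (k + 2))
      (b ^ k * Real.exp (-b ^ 2 / 4) * (2 * (k + 1) - b ^ 2 + 4 * b)) b := by
  have h := ((hasDerivAt_pow_succ_mul_gaussian k b).const_mul 2).add
    ((hasDerivAt_integral_pow_mul_gaussian (k + 1) b).const_mul 4)
  refine (h.congr_deriv ?_).congr_of_eventuallyEq (.of_forall fun x => ?_)
  · ring
  · simp only [rectG, show k + 2 - 1 = k + 1 by omega, Pi.add_apply, mul_assoc]

theorem log_le_half_sub_inv {x : ℝ} (hx : 1 ≤ x) : Real.log x ≤ (x - x⁻¹) / 2 := by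
  rw [← Real.sinh_log (by linarith)]
  exact Real.self_le_sinh_iff.2 (Real.log_nonneg hx)

theorem pow_mul_gaussian_add_two_le_sub_two {m : ℕ} {s : ℝ} (hs : 2 < s)
    (hm : 2 * (m : ℝ) ≤ s ^ 2 - 4) :
    (s + 2) ^ m * Real.exp (-(s + 2) ^ 2 / 4) ≤ (s - 2) ^ m * Real.exp (-(s - 2) ^ 2 / 4) := by
  have h1 : 0 < s - 2 := by linarith
  have h2 : 0 < s + 2 := by linarith
  have h3 : 0 < s ^ 2 - 4 := by nlinarith
  have hlog := log_le_half_sub_inv (x := (s + 2) / (s - 2))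
    (by rw [le_div_iff₀ h1]; linarith)
  have hval : ((s + 2) / (s - 2) - ((s + 2) / (s - 2))⁻¹) / 2 = 4 * s / (s ^ 2 - 4) := by
    rw [show s ^ 2 - 4 = (s - 2) * (s + 2) by ring]
    field_simp
    ring
  rw [hval, Real.log_div h2.ne' h1.ne'] at hlog
  have hmul : (m : ℝ) * (4 * s / (s ^ 2 - 4)) ≤ 2 * s := by
    rw [mul_div_assoc', div_le_iff₀ h3]
    nlinarith
  have hmlog := mul_le_mul_of_nonneg_left hlog (Nat.cast_nonneg (α := ℝ) m)
  rw [← Real.log_le_log_iff (by positivity) (by positivity),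
    Real.log_mul (by positivity) (Real.exp_ne_zero _),
    Real.log_mul (by positivity) (Real.exp_ne_zero _), Real.log_pow, Real.log_pow,
    Real.log_exp, Real.log_exp]
  nlinarith

theorem rectF_sub_add_rectG_sub_gt (k : ℕ) {r R : ℝ} (hr : 0 < r) (hR : 0 < R)
    (hr2 : r ^ 2 = 2 * k + 6) (hR2 : R ^ 2 = 2 * k + 10) :
    2 * ((R - 2) ^ (k + 1) * Real.exp (-(R - 2) ^ 2 / 4) +
        (R + 2) ^ (k + 1) * Real.exp (-(R + 2) ^ 2 / 4)) <
      (k + 2) * (rectF (k + 2) (r - 2) - rectF (k + 2) (R - 2) +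
        (rectG (k + 2) (r + 2) - rectG (k + 2) (R + 2))) := by
  have hk : (0 : ℝ) ≤ k := Nat.cast_nonneg k
  have hrR : r < R := by nlinarith
  have hr2' : 2 < r := by nlinarith
  let P : ℝ → ℝ := fun x =>
    (k + 2) * (rectF (k + 2) (r - 2) - rectF (k + 2) (x - 2) +
        (rectG (k + 2) (r + 2) - rectG (k + 2) (x + 2))) -
      (x ^ 2 - r ^ 2) ^ 2 / 8 * ((x - 2) ^ (k + 1) * Real.exp (-(x - 2) ^ 2 / 4) +
        (x + 2) ^ (k + 1) * Real.exp (-(x + 2) ^ 2 / 4))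
  have hP : ∀ x, HasDerivAt P
      ((x ^ 2 - r ^ 2) * (1 - (x ^ 2 - r ^ 2) / 4) *
        ((x - 2) ^ k * Real.exp (-(x - 2) ^ 2 / 4) * (x - (1 + (x ^ 2 - r ^ 2) / 4)) -
          (x + 2) ^ k * Real.exp (-(x + 2) ^ 2 / 4) * (x + (1 + (x ^ 2 - r ^ 2) / 4)))) x := by
    intro x
    have hF := (hasDerivAt_rectF k (x - 2)).comp_sub_const x 2
    have hG := (hasDerivAt_rectG k (x + 2)).comp_add_const x 2
    have hW := ((hasDerivAt_pow_succ_mul_gaussian k (x - 2)).comp_sub_const x 2).add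
      ((hasDerivAt_pow_succ_mul_gaussian k (x + 2)).comp_add_const x 2)
    have hc := (((hasDerivAt_pow 2 x).sub_const (r ^ 2)).pow 2).div_const 8
    have h := (((hF.const_sub (rectF (k + 2) (r - 2))).add
      (hG.const_sub (rectG (k + 2) (r + 2)))).const_mul ((k : ℝ) + 2)).sub (hc.mul hW)
    refine h.congr_deriv ?_
    have hkr : (k : ℝ) = (r ^ 2 - 6) / 2 := by linarith
    simp only [Pi.add_apply, Pi.pow_apply]
    generalize Real.exp (-(x - 2) ^ 2 / 4) = e₁
    generalize Real.exp (-(x + 2) ^ 2 / 4) = e₂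
    rw [pow_succ (x - 2) k, pow_succ (x + 2) k]
    generalize (x - 2) ^ k = p₁
    generalize (x + 2) ^ k = p₂
    rw [hkr]
    push_cast
    ring
  have hmono : StrictMonoOn P (Set.Icc r R) := by
    apply strictMonoOn_of_deriv_pos (convex_Icc r R)
    · exact fun x _ => (hP x).continuousAt.continuousWithinAt
    intro x hx
    rw [interior_Icc] at hx
    obtain ⟨hx1, hx2⟩ := hx
    rw [(hP x).deriv]
    have hu0 : 0 < x ^ 2 - r ^ 2 := by nlinarith
    have hu4 : x ^ 2 - r ^ 2 < 4 := by nlinarith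
    have hw := pow_mul_gaussian_add_two_le_sub_two (m := k + 1) (s := x) (by linarith)
      (by push_cast; linarith)
    have hp₁ : 0 < (x - 2) ^ k * Real.exp (-(x - 2) ^ 2 / 4) :=
      mul_pos (pow_pos (by linarith) k) (Real.exp_pos _)
    have hp₂ : 0 < (x + 2) ^ k * Real.exp (-(x + 2) ^ 2 / 4) :=
      mul_pos (pow_pos (by linarith) k) (Real.exp_pos _)
    rw [pow_succ (x + 2) k, pow_succ (x - 2) k] at hw
    refine mul_pos (mul_pos hu0 (by linarith)) ?_
    nlinarith [mul_pos hp₁ (by linarith : 0 < 1 - (x ^ 2 - r ^ 2) / 4),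
      mul_pos hp₂ (by linarith : 0 < 1 - (x ^ 2 - r ^ 2) / 4)]
  have h := hmono (Set.left_mem_Icc.2 hrR.le) (Set.right_mem_Icc.2 hrR.le) hrR
  have hRr : R ^ 2 - r ^ 2 = 4 := by linarith
  simp only [P, sub_self, hRr] at h
  norm_num at h
  linarith

/-- **Claim 4.3 (the induction step):** for `n ≥ 3`,
`F_{n+2}(a_{n+2}) + G_{n+2}(b_{n+2}) < 2n (F_n(a_n) + G_n(b_n))`. -/
theorem rect_induction_step (n : ℕ) (hn : 3 ≤ n) :
    rectF (n + 2) (rectA (n + 2)) + rectG (n + 2) (rectB (n + 2))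
      < 2 * n * (rectF n (rectA n) + rectG n (rectB n)) := by
  obtain ⟨k, rfl⟩ : ∃ k, n = k + 2 := ⟨n - 2, by omega⟩
  have hr0 : (0 : ℝ) < 2 * (((k + 2 : ℕ) : ℝ) + 1) := by positivity
  have hR0 : (0 : ℝ) < 2 * (((k + 2 + 2 : ℕ) : ℝ) + 1) := by positivity
  have hr2 := Real.sq_sqrt hr0.le
  have hR2 := Real.sq_sqrt hR0.le
  have hr := Real.sqrt_pos.2 hr0
  have hR := Real.sqrt_pos.2 hR0
  unfold rectA rectB
  generalize √(2 * (((k + 2 : ℕ) : ℝ) + 1)) = r at *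
  generalize √(2 * (((k + 2 + 2 : ℕ) : ℝ) + 1)) = R at *
  push_cast at hr2 hR2 ⊢
  rw [neg_add_eq_sub, neg_add_eq_sub, add_comm 2 R, add_comm 2 r, rectF_add_two, rectG_add_two,
    show (R - 2) ^ 2 + 4 * (R - 2) - 2 * ((k : ℝ) + 2) = 2 by linarith,
    show (R + 2) ^ 2 - 4 * (R + 2) - 2 * ((k : ℝ) + 2) = 2 by linarith]
  linarith [rectF_sub_add_rectG_sub_gt k hr hR (by linarith) (by linarith)]
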